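/- Let G be a finite simple graph that is k-extendable, and let M = {e_1, ..., e_{k+1}} be a matching of G with k+1 edges that is not extendable. Then there exists a set S of vertices of G such that S contains all endpoints of the edges e_1, ..., e_{k+1}, and |S| = C_o(G − S) + 2k, where C_o(G − S) is the number of connected components of odd order of the graph obtained from G by deleting the vertices of S. -/

import Mathlib

/-- The number of connected components of odd order of a simple graph. -/
noncomputable def oddComponentsCount {W : Type*} (H : SimpleGraph W) : ℕ :=
  Nat.card {c : H.ConnectedComponent // Odd (Nat.card c.supp)}

open SimpleGraph

/-- The count of odd components is the cardinality of Mathlib's set of odd components. -/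
lemma oddComponentsCount_eq {W : Type*} (H : SimpleGraph W) :
    oddComponentsCount H = H.oddComponents.ncard := rfl

/-- The count of odd components is invariant under isomorphism. -/
lemma oddComponentsCount_iso {W W' : Type*} {H : SimpleGraph W} {H' : SimpleGraph W'}
    (φ : H ≃g H') : oddComponentsCount H = oddComponentsCount H' := by
  refine Nat.card_congr (φ.connectedComponentEquiv.subtypeEquiv fun c => ?_)
  rw [Nat.card_congr (ConnectedComponent.isoEquivSupp φ c)]

/-- Deleting vertices is the same as inducing on the complement. -/
def deleteVertsIso {W : Type*} (H : SimpleGraph W) (u : Set W) :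
    ((⊤ : H.Subgraph).deleteVerts u).coe ≃g H.induce uᶜ where
  toEquiv := Equiv.subtypeEquivRight (by simp)
  map_rel_iff' := by
    rintro ⟨a, ha⟩ ⟨b, hb⟩
    simp at ha hb
    simp [ha, hb]

/-- Deleting vertices in two rounds. -/
def induceInduceIso {V : Type*} (G : SimpleGraph V) (A : Set V) (T : Set (Aᶜ : Set V)) :
    (G.induce Aᶜ).induce Tᶜ ≃g G.induce (A ∪ Subtype.val '' T)ᶜ where
  toFun x := ⟨x.1.1, by
    rintro (h | ⟨y, hy, h⟩)
    · exact x.1.2 h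
    · exact x.2 (by rwa [← Subtype.ext h])⟩
  invFun y := ⟨⟨y.1, fun h => y.2 (Or.inl h)⟩, fun h => y.2 (Or.inr ⟨_, h, rfl⟩)⟩
  left_inv _ := rfl
  right_inv _ := rfl
  map_rel_iff' := Iff.rfl

/-- Removing one edge from a matching. -/
lemma matching_remove {V : Type*} [Finite V] {G : SimpleGraph V} (M : G.Subgraph)
    (hM : M.IsMatching) {n : ℕ} (hn : M.edgeSet.ncard = n + 1) :
    ∃ N : G.Subgraph, N ≤ M ∧ N.IsMatching ∧ N.edgeSet.ncard = n ∧
      M.verts.ncard = N.verts.ncard + 2 := by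
  have hne : M.edgeSet.Nonempty := by
    rw [← Set.ncard_pos (Set.toFinite _)]; omega
  obtain ⟨e, he⟩ := hne
  induction e using Sym2.ind with
  | _ a b =>
  have hab : M.Adj a b := he
  have huniq : ∀ x y, M.Adj x y → (x = a ∨ x = b) → (y = a ∨ y = b) := by
    rintro x y hxy (rfl | rfl)
    · exact Or.inr (hM.eq_of_adj_left hxy hab)
    · exact Or.inl (hM.eq_of_adj_left hxy hab.symm)
  have huniq2 : ∀ x y, M.Adj x y → (x = a ∨ x = b) → s(x, y) = s(a, b) := by
    rintro x y hxy (rfl | rfl)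
    · rw [hM.eq_of_adj_left hxy hab]
    · rw [hM.eq_of_adj_left hxy hab.symm, Sym2.eq_swap]
  refine ⟨M.deleteVerts {a, b}, Subgraph.deleteVerts_le, ?_, ?_, ?_⟩
  · intro v hv
    obtain ⟨hv, hv'⟩ := hv
    obtain ⟨w, hw, hw'⟩ := hM hv
    have hwn : w ∉ ({a, b} : Set V) := fun h => hv' (huniq w v hw.symm h)
    refine ⟨w, ?_, ?_⟩
    · simp only [Subgraph.deleteVerts_adj]
      exact ⟨hv, hv', hw.snd_mem, hwn, hw⟩
    · intro y hy
      exact hw' y (Subgraph.deleteVerts_le.2 hy)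
  · have : (M.deleteVerts {a, b}).edgeSet = M.edgeSet \ {s(a, b)} := by
      ext e
      induction e using Sym2.ind with
      | _ x y =>
      simp only [Subgraph.mem_edgeSet, Subgraph.deleteVerts_adj, Set.mem_sdiff,
        Set.mem_singleton_iff]
      constructor
      · rintro ⟨_, h1, _, _, h3⟩
        refine ⟨h3, fun h => h1 ?_⟩
        have : x ∈ s(a, b) := h ▸ Sym2.mem_mk_left x y
        simpa using this
      · rintro ⟨h1, h2⟩
        refine ⟨h1.fst_mem, fun h => h2 (huniq2 x y h1 h), h1.snd_mem, fun h => h2 ?_, h1⟩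
        rw [Sym2.eq_swap]
        exact huniq2 y x h1.symm h
    rw [this, Set.ncard_sdiff_singleton_of_mem he, hn]
    rfl
  · have hsub : ({a, b} : Set V) ⊆ M.verts := by
      rintro x (rfl | rfl)
      · exact hab.fst_mem
      · exact hab.snd_mem
    rw [Subgraph.deleteVerts_verts, ← Set.ncard_sdiff_add_ncard_of_subset hsub (Set.toFinite _),
      Set.ncard_pair hab.ne]

/-- A matching with `n` edges covers `2n` vertices. -/
lemma matching_card {V : Type*} [Finite V] {G : SimpleGraph V} (n : ℕ) : ∀ M : G.Subgraph,
    M.IsMatching → M.edgeSet.ncard = n → M.verts.ncard = 2 * n := by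
  induction n with
  | zero =>
    intro M hM h
    rw [Set.ncard_eq_zero (Set.toFinite _)] at h
    rw [hM.verts_eq_biUnion_edgeSet, h]
    simp
  | succ n ih =>
    intro M hM h
    obtain ⟨N, _, hN, hNc, hv⟩ := matching_remove M hM h
    rw [hv, ih N hN hNc]
    ring

/-- Upper bound on the number of odd components from a perfect matching extending `N`. -/
lemma odd_le {V : Type*} [Finite V] {G : SimpleGraph V} (N P : G.Subgraph)
    (hN : N.IsMatching) (hP : P.IsPerfectMatching) (hNP : N ≤ P) (S : Set V)
    (hS : N.verts ⊆ S) :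
    oddComponentsCount (G.induce Sᶜ) ≤ (S \ N.verts).ncard := by
  rw [← oddComponentsCount_iso (deleteVertsIso G S), oddComponentsCount_eq]
  choose f hf g hgf hg using ConnectedComponent.odd_matches_node_outside hP (u := S)
  have hfinj : f.Injective := fun c d hcd ↦ by
    replace hcd : g c = g d := Subtype.val_injective <| hP.1.eq_of_adj_right (hgf c) (hcd ▸ hgf d)
    exact Subtype.val_injective <| ConnectedComponent.eq_of_common_vertex (hg c) (hcd ▸ hg d)
  have hf2 : ∀ c, f c ∈ S \ N.verts := by
    intro c
    refine ⟨hf c, fun h => ?_⟩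
    obtain ⟨w, hw, _⟩ := hN h
    have h1 := hP.1.eq_of_adj_left (hNP.2 hw) (hgf c).symm
    have h2 := (g c).2.2
    exact h2 (h1 ▸ hS hw.snd_mem)
  exact Nat.card_le_card_of_injective (fun c ↦ (⟨f c, hf2 c⟩ : (S \ N.verts : Set V)))
    (fun c d h ↦ hfinj (congrArg Subtype.val h))

/-- Blocker lemma (Fujisawa, Segawa, Suzuki): if `G` is a `k`-extendable finite simple graph
(`G` has at least `2k+2` vertices and every matching with `k` edges extends to a perfect
matching) and `M` is a matching of `G` with `k+1` edges that is not extendable, then there is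
a set `S` of vertices containing all vertices covered by `M` with
`|S| = C_o(G - S) + 2k`, where `C_o(G - S)` is the number of odd components of the graph
obtained from `G` by deleting the vertices of `S`. -/
theorem stmt_3 {V : Type*} [Fintype V] (G : SimpleGraph V) (k : ℕ)
    (hcard : 2 * k + 2 ≤ Fintype.card V)
    (hkext : ∀ N : G.Subgraph, N.IsMatching → N.edgeSet.ncard = k →
      ∃ P : G.Subgraph, P.IsPerfectMatching ∧ N ≤ P)
    (M : G.Subgraph) (hM : M.IsMatching) (hMcard : M.edgeSet.ncard = k + 1)
    (hnotext : ¬ ∃ P : G.Subgraph, P.IsPerfectMatching ∧ M ≤ P) :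
    ∃ S : Set V, M.verts ⊆ S ∧
      S.ncard = oddComponentsCount (G.induce Sᶜ) + 2 * k := by
  obtain ⟨N, hNM, hN, hNc, hv⟩ := matching_remove M hM hMcard
  obtain ⟨P, hP, hNP⟩ := hkext N hN hNc
  have hNv := matching_card k N hN hNc
  have heven := hP.even_card
  have hno : ¬ ∃ Q : (G.induce M.vertsᶜ).Subgraph, Q.IsPerfectMatching := by
    rintro ⟨Q, hQ⟩
    apply hnotext
    let Q' : G.Subgraph := Q.map (Embedding.induce (G := G) M.vertsᶜ).toHom
    have hQ' : Q'.IsMatching := hQ.1.map _ (Embedding.induce (G := G) M.vertsᶜ).injective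
    have hQv : Q'.verts = M.vertsᶜ := by
      ext x
      simp [Q', Subgraph.map, hQ.2.verts_eq_univ]
    refine ⟨M ⊔ Q', ⟨hM.sup hQ' ?_, ?_⟩, le_sup_left⟩
    · rw [hM.support_eq_verts, hQ'.support_eq_verts, hQv]
      exact disjoint_compl_right
    · intro v
      rw [Subgraph.verts_sup, hQv, Set.union_compl_self]
      trivial
  rw [tutte] at hno
  push Not at hno
  obtain ⟨T, hT⟩ := hno
  rw [IsTutteViolator, ← oddComponentsCount_eq, oddComponentsCount_iso (deleteVertsIso _ T),
    oddComponentsCount_iso (induceInduceIso G M.verts T)] at hT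
  set S : Set V := M.verts ∪ Subtype.val '' T with hS
  have hMS : M.verts ⊆ S := Set.subset_union_left
  have hNS : N.verts ⊆ S := hNM.1.trans hMS
  have hup := odd_le N P hN hP hNP S hNS
  have hSN := Set.ncard_sdiff_add_ncard_of_subset hNS (Set.toFinite _)
  have hScard : S.ncard = M.verts.ncard + T.ncard := by
    rw [hS, Set.ncard_union_eq, Set.ncard_image_of_injective _ Subtype.val_injective]
    rw [Set.disjoint_left]
    rintro x hx ⟨y, _, rfl⟩
    exact y.2 hx
  have hpar := odd_ncard_oddComponents (G.induce Sᶜ)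
  rw [← oddComponentsCount_eq, Nat.card_coe_set_eq] at hpar
  have hcompl := Set.ncard_add_ncard_compl S
  rw [Nat.card_eq_fintype_card] at hcompl
  refine ⟨S, hMS, ?_⟩
  rw [Nat.odd_iff, Nat.odd_iff] at hpar
  rw [Nat.even_iff] at heven
  omega
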